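/- arXiv:2601.10297 — 2 statements merged into one kernel-verified Lean document; each statement's English description precedes it below -/
import Mathlib

section
/- Let B ⊂ ℝ^n be a ball centered at 0 and let u(x) = (1/2)·x_n² for x_n > 0, u(x) = 0 for x_n ≤ 0. Suppose v ∈ H²(B) satisfies Δv = χ_{{v ≠ 0}} almost everywhere in B and v − u ∈ H₀²(B). Then v = u in B. -/
open MeasureTheory Metric Set Filter Topology
open scoped ENNReal

noncomputable section

/-- `n`-dimensional Euclidean space. -/
abbrev RH (n : ℕ) := EuclideanSpace ℝ (Fin n)

variable {n : ℕ}

/-- Smooth compactly supported test functions with support contained in `Ω`. -/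
def IsTestFun (Ω : Set (RH n)) (φ : RH n → ℝ) : Prop :=
  ContDiff ℝ (⊤ : ℕ∞) φ ∧ HasCompactSupport φ ∧ tsupport φ ⊆ Ω

/-- Classical partial derivative in the `i`-th coordinate direction. -/
def cpderiv (i : Fin n) (φ : RH n → ℝ) : RH n → ℝ :=
  fun x => fderiv ℝ φ x (EuclideanSpace.single i 1)

/-- Classical Laplacian of a (smooth) function. -/
def cLaplacian (φ : RH n → ℝ) : RH n → ℝ :=
  fun x => ∑ i, cpderiv i (cpderiv i φ) x

/-- `g` is the weak `i`-th partial derivative of `u` on `Ω`. -/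
def IsWeakPartial (Ω : Set (RH n)) (i : Fin n) (u g : RH n → ℝ) : Prop :=
  ∀ φ : RH n → ℝ, IsTestFun Ω φ →
    ∫ x in Ω, u x * cpderiv i φ x = - ∫ x in Ω, g x * φ x

/-- `g` is a weak Laplacian of `u` on `Ω`. -/
def IsWeakLaplacian (Ω : Set (RH n)) (u g : RH n → ℝ) : Prop :=
  ∀ φ : RH n → ℝ, IsTestFun Ω φ →
    ∫ x in Ω, u x * cLaplacian φ x = ∫ x in Ω, g x * φ x

/-- `u ∈ H²(Ω)` with weak gradient `g` and weak Hessian `h`. -/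
def IsH2With (Ω : Set (RH n)) (u : RH n → ℝ) (g : Fin n → RH n → ℝ)
    (h : Fin n → Fin n → RH n → ℝ) : Prop :=
  MemLp u 2 (volume.restrict Ω) ∧
  (∀ i, IsWeakPartial Ω i u (g i) ∧ MemLp (g i) 2 (volume.restrict Ω)) ∧
  (∀ i j, IsWeakPartial Ω j (g i) (h i j) ∧ MemLp (h i j) 2 (volume.restrict Ω))

/-- `u ∈ H²(Ω)`. -/
def MemH2 (Ω : Set (RH n)) (u : RH n → ℝ) : Prop :=
  ∃ g h, IsH2With Ω u g h

/-- `u ∈ H₀²(Ω)`: `u ∈ H²(Ω)` and `u` is approximable in the `H²`-norm by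
test functions supported in `Ω`. -/
def MemH20 (Ω : Set (RH n)) (u : RH n → ℝ) : Prop :=
  ∃ g h, IsH2With Ω u g h ∧
    ∃ φ : ℕ → RH n → ℝ, (∀ k, IsTestFun Ω (φ k)) ∧
      Tendsto (fun k => eLpNorm (fun x => u x - φ k x) 2 (volume.restrict Ω)) atTop (𝓝 0) ∧
      (∀ i, Tendsto (fun k => eLpNorm (fun x => g i x - cpderiv i (φ k) x) 2
        (volume.restrict Ω)) atTop (𝓝 0)) ∧
      (∀ i j, Tendsto (fun k => eLpNorm (fun x => h i j x - cpderiv j (cpderiv i (φ k)) x) 2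
        (volume.restrict Ω)) atTop (𝓝 0))

/-- `u ∈ H²_loc(ℝⁿ)`. -/
def MemH2loc (u : RH n → ℝ) : Prop :=
  ∀ Ω : Set (RH n), IsOpen Ω → Bornology.IsBounded Ω → MemH2 Ω u

/-- The two-sided biharmonic Alt–Caffarelli functional
`F(u,Ω) = ∫_Ω (Δu)² dx + |{x ∈ Ω : u x ≠ 0}|`, where the (weak) Laplacian
`Δu = lapu` is given explicitly. -/
def ACF (Ω : Set (RH n)) (lapu u : RH n → ℝ) : ℝ :=
  (∫ x in Ω, (lapu x) ^ 2) + (volume {x ∈ Ω | u x ≠ 0}).toReal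

/-- `u` is a global minimizer of the two-sided biharmonic Alt–Caffarelli functional. -/
def IsGlobalMinimizer (u : RH n → ℝ) : Prop :=
  MemH2loc u ∧
  ∀ Ω : Set (RH n), IsOpen Ω → Bornology.IsBounded Ω →
    ∀ v : RH n → ℝ, MemH2 Ω v → MemH20 Ω (fun x => v x - u x) →
      ∀ lapu lapv : RH n → ℝ, IsWeakLaplacian Ω u lapu → IsWeakLaplacian Ω v lapv →
        ACF Ω lapu u ≤ ACF Ω lapv v


/-- The half-space function `u(x) = ½ xₙ² 𝟙_{xₙ>0}`. -/
def uHalf (n : ℕ) (hn : 0 < n) : RH n → ℝ := fun x =>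
  if 0 < x ⟨n - 1, by omega⟩ then (x ⟨n - 1, by omega⟩) ^ 2 / 2 else 0

lemma hasFDerivAt_comp_coord (j : Fin n) {f : ℝ → ℝ} {f' : ℝ} {x : RH n}
    (hf : HasDerivAt f f' (x j)) :
    HasFDerivAt (fun y : RH n => f (y j)) (f' • (EuclideanSpace.proj j : RH n →L[ℝ] ℝ)) x :=
  HasDerivAt.comp_hasFDerivAt (f := fun y : RH n => y j) x hf
    (EuclideanSpace.proj j : RH n →L[ℝ] ℝ).hasFDerivAt

lemma integrable_mul_of_memLp_two {α : Type*} [MeasurableSpace α] {μ : Measure α} {f g : α → ℝ}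
    (hf : MemLp f 2 μ) (hg : MemLp g 2 μ) : Integrable (fun x => f x * g x) μ :=
  hf.integrable_mul hg

lemma IsTestFun.isTestFun_cpderiv {Ω : Set (RH n)} {φ : RH n → ℝ} (hφ : IsTestFun Ω φ)
    (i : Fin n) : IsTestFun Ω (cpderiv i φ) := by
  obtain ⟨h1, h2, h3⟩ := hφ
  refine ⟨?_, h2.fderiv_apply (𝕜 := ℝ) _, (tsupport_fderiv_apply_subset ℝ _).trans h3⟩
  exact (h1.fderiv_right (m := ((⊤ : ℕ∞) : WithTop ℕ∞)) le_rfl).clm_apply contDiff_const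

lemma IsTestFun.memLp {Ω : Set (RH n)} {φ : RH n → ℝ} (hφ : IsTestFun Ω φ) (p : ℝ≥0∞)
    (μ : Measure (RH n)) [IsFiniteMeasureOnCompacts μ] : MemLp φ p μ :=
  hφ.1.continuous.memLp_of_hasCompactSupport hφ.2.1

lemma IsTestFun.isTestFun_cLaplacian {Ω : Set (RH n)} {φ : RH n → ℝ} (hφ : IsTestFun Ω φ) :
    IsTestFun Ω (cLaplacian φ) := by
  have h := fun i => (hφ.isTestFun_cpderiv i).isTestFun_cpderiv i
  have hz : ∀ x ∉ tsupport φ, cLaplacian φ x = 0 := fun x hx => by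
    refine Finset.sum_eq_zero fun i _ => ?_
    by_contra hne
    exact hx (((tsupport_fderiv_apply_subset ℝ _).trans (tsupport_fderiv_apply_subset ℝ _))
      (subset_tsupport (cpderiv i (cpderiv i φ)) hne))
  refine ⟨ContDiff.sum fun i _ => (h i).1, HasCompactSupport.intro hφ.2.1 hz, ?_⟩
  refine (closure_minimal (fun x hx => ?_) (isClosed_tsupport φ)).trans hφ.2.2
  by_contra hx'
  exact hx (hz x hx')

/-- An integral against a test function over `Ω` is an integral over the whole space. -/
lemma IsTestFun.setIntegral_mul {Ω : Set (RH n)} {φ : RH n → ℝ} (hφ : IsTestFun Ω φ)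
    (f : RH n → ℝ) : ∫ x in Ω, f x * φ x = ∫ x, f x * φ x := by
  refine setIntegral_eq_integral_of_forall_compl_eq_zero fun x hx => ?_
  rw [image_eq_zero_of_notMem_tsupport (fun h => hx (hφ.2.2 h)), mul_zero]

lemma IsTestFun.integrable_mul {Ω : Set (RH n)} {φ f : RH n → ℝ} (hφ : IsTestFun Ω φ)
    (hf : Continuous f) : Integrable (fun x => f x * φ x) :=
  (hf.mul hφ.1.continuous).integrable_of_hasCompactSupport hφ.2.1.mul_left

/-- Integration by parts of a test function against a `C¹` function. -/
lemma IsTestFun.integral_mul_cpderiv {Ω : Set (RH n)} {φ : RH n → ℝ} (hφ : IsTestFun Ω φ)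
    (i : Fin n) {f f' : RH n → ℝ} (hf : Differentiable ℝ f) (hf' : ∀ x, cpderiv i f x = f' x)
    (hc : Continuous f') :
    ∫ x, f x * cpderiv i φ x = - ∫ x, f' x * φ x := by
  obtain rfl : cpderiv i f = f' := funext hf'
  exact integral_mul_fderiv_eq_neg_fderiv_mul_of_integrable (hφ.integrable_mul hc)
    ((hφ.isTestFun_cpderiv i).integrable_mul hf.continuous) (hφ.integrable_mul hf.continuous)
    (fun x _ => hf x) (fun x _ => hφ.1.differentiable (by simp) x)

lemma cpderiv_comp_coord (i j : Fin n) {f : ℝ → ℝ} {f' : ℝ} {x : RH n}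
    (hf : HasDerivAt f f' (x j)) :
    cpderiv i (fun y => f (y j)) x = if i = j then f' else 0 := by
  simp [cpderiv, (hasFDerivAt_comp_coord j hf).fderiv, eq_comm]

lemma IsTestFun.integral_sq_le_cpderiv {R : ℝ} {φ : RH n → ℝ} (hφ : IsTestFun (ball 0 R) φ)
    (i : Fin n) : ∫ x, φ x * φ x ≤ 4 * R ^ 2 * ∫ x, cpderiv i φ x * cpderiv i φ x := by
  have hφd := hφ.1.differentiable (by simp)
  have hφc := hφ.1.continuous
  have hφi := hφ.isTestFun_cpderiv i
  have hc : Continuous fun x : RH n => x i := by fun_prop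
  have hm : ∀ x, cpderiv i (fun y => y i * φ y) x = φ x + x i * cpderiv i φ x := fun x => by
    have h1 : DifferentiableAt ℝ (fun y : RH n => y i) x := by fun_prop
    have h2 := cpderiv_comp_coord i i (x := x) (hasDerivAt_id _)
    simp only [cpderiv, id] at h2 ⊢
    rw [fderiv_fun_mul h1 (hφd x)]
    simp [h2]
    ring
  have h := hφ.integral_mul_cpderiv i (f := fun y => y i * φ y) (by fun_prop) hm
    (hφc.add (hc.mul hφi.1.continuous))
  have I1 : Integrable fun x => φ x * φ x := hφ.integrable_mul hφc
  have I2 : Integrable fun x => x i * cpderiv i φ x * φ x :=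
    hφ.integrable_mul (hc.mul hφi.1.continuous)
  have I3 : Integrable fun x => cpderiv i φ x * cpderiv i φ x :=
    hφi.integrable_mul hφi.1.continuous
  have e1 : ∫ x, x i * φ x * cpderiv i φ x = ∫ x, x i * cpderiv i φ x * φ x := by
    congr 1; ext x; ring
  simp only [add_mul] at h
  rw [integral_add I1 I2, e1] at h
  have h3 : -2 * ∫ x, x i * cpderiv i φ x * φ x ≤
      ∫ x, (1 / 2 * (φ x * φ x) + 2 * R ^ 2 * (cpderiv i φ x * cpderiv i φ x)) := by
    rw [← integral_const_mul]
    refine integral_mono (I2.const_mul _) ((I1.const_mul _).add (I3.const_mul _)) fun x => ?_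
    simp only
    by_cases hx : x ∈ tsupport φ
    · have hx' : x i ^ 2 ≤ R ^ 2 := by
        have h1 : ‖x‖ < R := by simpa using hφ.2.2 hx
        have h2 : |x i| ≤ ‖x‖ := by simpa using PiLp.norm_apply_le x i
        exact sq_le_sq' (by linarith [abs_le.1 h2]) (by linarith [abs_le.1 h2])
      nlinarith [sq_nonneg (φ x + 2 * x i * cpderiv i φ x),
        mul_le_mul_of_nonneg_right hx' (sq_nonneg (cpderiv i φ x))]
    · rw [image_eq_zero_of_notMem_tsupport hx]
      nlinarith [sq_nonneg R, mul_nonneg (sq_nonneg R) (mul_self_nonneg (cpderiv i φ x))]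
  rw [integral_add (I1.const_mul _) (I3.const_mul _), integral_const_mul, integral_const_mul] at h3
  linarith

/-- The `L²` norm of a test function is controlled by that of its Laplacian. -/
lemma IsTestFun.integral_sq_le_cLaplacian {R : ℝ} {φ : RH n → ℝ} (hφ : IsTestFun (ball 0 R) φ)
    (i : Fin n) :
    ∫ x, φ x ^ 2 ≤ (4 * R ^ 2) ^ 2 * ∫ x, cLaplacian φ x ^ 2 := by
  have hφc := hφ.1.continuous
  have hφi := fun j => hφ.isTestFun_cpderiv j
  have h1 := hφ.integral_sq_le_cpderiv i
  have hL := hφ.isTestFun_cLaplacian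
  have I1 : Integrable fun x => φ x * φ x := hφ.integrable_mul hφc
  have I2 : Integrable fun x => cLaplacian φ x * cLaplacian φ x :=
    hL.integrable_mul hL.1.continuous
  have I3 : Integrable fun x => φ x * cLaplacian φ x := hL.integrable_mul hφc
  have h2 : ∑ j, ∫ x, cpderiv j φ x * cpderiv j φ x = - ∫ x, φ x * cLaplacian φ x := by
    simp only [cLaplacian, Finset.mul_sum]
    rw [integral_finsetSum _ fun j _ => ((hφi j).isTestFun_cpderiv j).integrable_mul hφc,
      ← Finset.sum_neg_distrib]
    refine Finset.sum_congr rfl fun j _ => ?_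
    rw [(hφi j).integral_mul_cpderiv j (hφ.1.differentiable (by simp)) (fun _ => rfl)
      (hφi j).1.continuous, neg_neg]
  have h3 : ∫ x, cpderiv i φ x * cpderiv i φ x ≤ - ∫ x, φ x * cLaplacian φ x := by
    rw [← h2]
    exact Finset.single_le_sum (f := fun j => ∫ x, cpderiv j φ x * cpderiv j φ x)
      (fun j _ => integral_nonneg fun x => mul_self_nonneg _) (Finset.mem_univ i)
  have h4 : -(4 * R ^ 2) * ∫ x, φ x * cLaplacian φ x ≤ ∫ x, (1 / 2 * (φ x * φ x) +
      8 * R ^ 4 * (cLaplacian φ x * cLaplacian φ x)) := by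
    rw [← integral_const_mul]
    refine integral_mono (I3.const_mul _) ((I1.const_mul _).add (I2.const_mul _)) fun x => ?_
    simp only
    nlinarith [sq_nonneg (φ x + 4 * R ^ 2 * cLaplacian φ x)]
  rw [integral_add (I1.const_mul _) (I2.const_mul _), integral_const_mul, integral_const_mul] at h4
  simp only [pow_two (φ _), pow_two (cLaplacian φ _)]
  nlinarith [mul_le_mul_of_nonneg_left h3 (by positivity : 0 ≤ 4 * R ^ 2)]

lemma IsTestFun.eLpNorm_le_cLaplacian {R : ℝ} {φ : RH n → ℝ} (hφ : IsTestFun (ball 0 R) φ)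
    (i : Fin n) :
    eLpNorm φ 2 (volume.restrict (ball 0 R)) ≤ ENNReal.ofReal (4 * R ^ 2) *
      eLpNorm (cLaplacian φ) 2 (volume.restrict (ball 0 R)) := by
  have key : ∀ ψ : RH n → ℝ, IsTestFun (ball 0 R) ψ →
      eLpNorm ψ 2 (volume.restrict (ball 0 R)) = ENNReal.ofReal (√(∫ x, ψ x ^ 2)) := by
    intro ψ hψ
    rw [(hψ.memLp 2 _).eLpNorm_eq_integral_rpow_norm two_ne_zero ENNReal.ofNat_ne_top,
      Real.sqrt_eq_rpow]
    have h := hψ.setIntegral_mul ψ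
    simp only [← pow_two] at h
    simp [h]
  rw [key φ hφ, key _ hφ.isTestFun_cLaplacian, ← ENNReal.ofReal_mul (by positivity)]
  refine ENNReal.ofReal_le_ofReal (Real.sqrt_le_iff.2 ⟨by positivity, ?_⟩)
  rw [mul_pow, Real.sq_sqrt (integral_nonneg fun x => sq_nonneg _)]
  exact hφ.integral_sq_le_cLaplacian i

/-- Linear functions are orthogonal to Laplacians of test functions. -/
lemma IsTestFun.integral_coord_mul_cLaplacian {Ω : Set (RH n)} {φ : RH n → ℝ}
    (hφ : IsTestFun Ω φ) (j : Fin n) : ∫ x, x j * cLaplacian φ x = 0 := by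
  have hc : Continuous fun x : RH n => x j := by fun_prop
  have hφi := fun j => hφ.isTestFun_cpderiv j
  simp only [cLaplacian, Finset.mul_sum]
  rw [integral_finsetSum _ fun i _ => ((hφi i).isTestFun_cpderiv i).integrable_mul hc]
  refine Finset.sum_eq_zero fun i _ => ?_
  rw [(hφi i).integral_mul_cpderiv i (f := fun x => x j) (f' := fun _ => if i = j then 1 else 0) (by fun_prop)
      (fun x => cpderiv_comp_coord i j (x := x) (hasDerivAt_id _)) continuous_const,
    hφ.integral_mul_cpderiv i (f' := fun _ => 0) (by fun_prop) (fun x => by simp [cpderiv])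
      continuous_const]
  simp

lemma ae_coord_ne_zero (j : Fin n) : ∀ᵐ x : RH n, x j ≠ 0 := by
  have h := Measure.addHaar_submodule (volume : Measure (RH n))
    (LinearMap.ker (EuclideanSpace.proj j : RH n →L[ℝ] ℝ).toLinearMap) (by
      intro h
      have : EuclideanSpace.single j (1 : ℝ) ∈ LinearMap.ker
        (EuclideanSpace.proj j : RH n →L[ℝ] ℝ).toLinearMap := h ▸ trivial
      simp at this)
  rw [ae_iff]
  convert h using 2
  ext x
  simp

lemma hasDerivAt_half_sq_posPart (t : ℝ) :
    HasDerivAt (fun s : ℝ => if 0 < s then s ^ 2 / 2 else 0) (max t 0) t := by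
  rcases lt_trichotomy t 0 with ht | rfl | ht
  · rw [max_eq_right ht.le]
    refine (hasDerivAt_const t (0 : ℝ)).congr_of_eventuallyEq ?_
    filter_upwards [gt_mem_nhds ht] with s hs
    simp [hs.le]
  · rw [max_self, hasDerivAt_iff_isLittleO_nhds_zero]
    have h : (fun s : ℝ => s ^ 2) =o[𝓝 0] fun s : ℝ => s := by
      simpa using Asymptotics.isLittleO_pow_pow (𝕜 := ℝ) (one_lt_two)
    refine Asymptotics.IsBigO.trans_isLittleO (Asymptotics.IsBigO.of_bound 1 ?_) h
    refine Eventually.of_forall fun s => ?_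
    simp only [zero_add, lt_irrefl, if_false, sub_zero, smul_zero, one_mul]
    split_ifs
    · rw [Real.norm_of_nonneg (by positivity), Real.norm_of_nonneg (by positivity)]
      nlinarith [sq_nonneg s]
    · simpa using sq_nonneg s
  · rw [max_eq_left ht.le]
    refine HasDerivAt.congr_of_eventuallyEq (f := fun s => s ^ 2 / 2) ?_ ?_
    · simpa using (hasDerivAt_pow 2 t).div_const 2
    · filter_upwards [lt_mem_nhds ht] with s hs
      simp [hs]

lemma hasDerivAt_posPart {t : ℝ} (ht : t ≠ 0) :
    HasDerivAt (fun s : ℝ => max s 0) (if 0 < t then 1 else 0) t := by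
  rcases ht.lt_or_gt with ht | ht
  · rw [if_neg ht.not_gt]
    refine (hasDerivAt_const t (0 : ℝ)).congr_of_eventuallyEq ?_
    filter_upwards [gt_mem_nhds ht] with s hs
    simp [hs.le]
  · rw [if_pos ht]
    refine (hasDerivAt_id t).congr_of_eventuallyEq ?_
    filter_upwards [lt_mem_nhds ht] with s hs
    simp [hs.le]

lemma IsTestFun.integral_posPart_mul_cpderiv {Ω : Set (RH n)} {φ : RH n → ℝ}
    (hφ : IsTestFun Ω φ) (j : Fin n) :
    ∫ x, max (x j) 0 * cpderiv j φ x = - ∫ x, (if 0 < x j then 1 else 0) * φ x := by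
  obtain ⟨C, hC⟩ := (hφ.1.of_le (by simp)).lipschitzWith_of_hasCompactSupport hφ.2.1 (𝕂 := ℝ)
    (one_ne_zero)
  have hL : LipschitzWith 1 fun x : RH n => max (x j) 0 :=
    (LipschitzWith.of_dist_le_mul fun x y => by
      simpa [dist_eq_norm] using PiLp.norm_apply_le (x - y) j).max_const 0
  have h := hL.integral_lineDeriv_mul_eq (μ := volume) hC hφ.2.1 (EuclideanSpace.single j 1)
  have e1 : ∫ x, lineDeriv ℝ (fun x : RH n => max (x j) 0) x (EuclideanSpace.single j 1) * φ x =
      ∫ x, (if 0 < x j then 1 else 0) * φ x := by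
    refine integral_congr_ae ?_
    filter_upwards [ae_coord_ne_zero j] with x hx
    have h2 := (hasFDerivAt_comp_coord j (hasDerivAt_posPart hx)).differentiableAt
      |>.lineDeriv_eq_fderiv (v := EuclideanSpace.single j 1)
    have h3 := cpderiv_comp_coord j j (hasDerivAt_posPart hx)
    simp only [cpderiv, if_true] at h3
    rw [h2, h3]
  rw [← e1, h, ← integral_neg]
  congr 1
  ext x
  rw [(hφ.1.differentiable (by simp) x).lineDeriv_eq_fderiv, map_neg, cpderiv]
  ring

lemma isWeakLaplacian_uHalf (hn : 0 < n) (Ω : Set (RH n)) :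
    IsWeakLaplacian Ω (uHalf n hn) (fun x => if 0 < x ⟨n - 1, by omega⟩ then 1 else 0) := by
  intro φ hφ
  set j : Fin n := ⟨n - 1, by omega⟩ with hj
  rw [hφ.isTestFun_cLaplacian.setIntegral_mul, hφ.setIntegral_mul]
  have hφi := fun j => hφ.isTestFun_cpderiv j
  have hd : Differentiable ℝ (uHalf n hn) := fun x =>
    (hasFDerivAt_comp_coord j (hasDerivAt_half_sq_posPart (x j))).differentiableAt
  have hp : ∀ i x, cpderiv i (uHalf n hn) x = if i = j then max (x j) 0 else 0 := fun i x =>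
    cpderiv_comp_coord i j (hasDerivAt_half_sq_posPart (x j))
  have hc : ∀ i, Continuous fun x : RH n => if i = j then max (x j) 0 else 0 := fun i => by
    split_ifs <;> fun_prop
  simp only [cLaplacian, Finset.mul_sum]
  rw [integral_finsetSum _ fun i _ => ((hφi i).isTestFun_cpderiv i).integrable_mul hd.continuous,
    Finset.sum_congr rfl fun i _ => (hφi i).integral_mul_cpderiv i hd (hp i) (hc i),
    Finset.sum_eq_single j (fun i _ hi => by simp [hi]) (by simp)]
  simp only [if_true]
  rw [hφ.integral_posPart_mul_cpderiv, neg_neg]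

lemma IsH2With.isWeakLaplacian {Ω : Set (RH n)} {u : RH n → ℝ} {g : Fin n → RH n → ℝ}
    {h : Fin n → Fin n → RH n → ℝ} (H : IsH2With Ω u g h) :
    IsWeakLaplacian Ω u (fun x => ∑ i, h i i x) := by
  intro φ hφ
  have hφi := fun j => hφ.isTestFun_cpderiv j
  simp only [cLaplacian, Finset.mul_sum, Finset.sum_mul]
  rw [integral_finsetSum _ fun i _ => integrable_mul_of_memLp_two H.1 (((hφi i).isTestFun_cpderiv i).memLp 2 _),
    integral_finsetSum _ fun i _ => integrable_mul_of_memLp_two (H.2.2 i i).2 (hφ.memLp 2 _)]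
  refine Finset.sum_congr rfl fun i _ => ?_
  rw [(H.2.1 i).1 _ (hφi i), (H.2.2 i i).1 _ hφ, neg_neg]

lemma tendsto_integral_mul_of_eLpNorm_two {α : Type*} [MeasurableSpace α] {μ : Measure α}
    {p f : α → ℝ} {F : ℕ → α → ℝ} (hp : MemLp p 2 μ) (hf : MemLp f 2 μ)
    (hF : ∀ k, MemLp (F k) 2 μ)
    (h : Tendsto (fun k => eLpNorm (fun x => f x - F k x) 2 μ) atTop (𝓝 0)) :
    Tendsto (fun k => ∫ x, p x * F k x ∂μ) atTop (𝓝 (∫ x, p x * f x ∂μ)) := by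
  refine tendsto_integral_of_L1' _ (integrable_mul_of_memLp_two hp hf).aestronglyMeasurable
    (Eventually.of_forall fun k => integrable_mul_of_memLp_two hp (hF k)) ?_
  have h0 : Tendsto (fun k => eLpNorm p 2 μ * eLpNorm (fun x => f x - F k x) 2 μ) atTop (𝓝 0) := by
    simpa using ENNReal.Tendsto.const_mul h (Or.inr hp.2.ne)
  refine tendsto_of_tendsto_of_tendsto_of_le_of_le tendsto_const_nhds h0 (fun _ => bot_le)
    fun k => ?_
  refine le_trans (le_of_eq ?_) (eLpNorm_smul_le_mul_eLpNorm (r := 1)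
    (hf.sub (hF k)).aestronglyMeasurable hp.aestronglyMeasurable)
  rw [← eLpNorm_neg]
  congr 1
  ext x
  simp
  ring

lemma memLp_coord_ball (R : ℝ) (j : Fin n) (p : ℝ≥0∞) :
    MemLp (fun x : RH n => x j) p (volume.restrict (ball 0 R)) := by
  have : IsFiniteMeasure (volume.restrict (ball (0 : RH n) R)) :=
    isFiniteMeasure_restrict.2 measure_ball_lt_top.ne
  refine MemLp.of_bound (by fun_prop) R ?_
  filter_upwards [ae_restrict_mem measurableSet_ball] with x hx
  exact (PiLp.norm_apply_le x j).trans (by simpa using (mem_ball.1 hx).le)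

/-- A function in `H₀²` of a ball has a weak Laplacian in `L²` which is orthogonal to linear
functions, and it vanishes if this Laplacian does. -/
lemma MemH20.exists_isWeakLaplacian {R : ℝ} {w : RH n → ℝ} (hw : MemH20 (ball 0 R) w)
    (j : Fin n) : ∃ f, IsWeakLaplacian (ball 0 R) w f ∧ MemLp f 2 (volume.restrict (ball 0 R)) ∧
      ∫ x in ball (0 : RH n) R, x j * f x = 0 ∧
      (f =ᵐ[volume.restrict (ball 0 R)] 0 → w =ᵐ[volume.restrict (ball 0 R)] 0) := by
  obtain ⟨g, h, H, φ, hφ, hφ0, -, hφ2⟩ := hw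
  set μ := volume.restrict (ball (0 : RH n) R) with hμ
  have hf : MemLp (fun x => ∑ i, h i i x) 2 μ := memLp_finsetSum _ fun i _ => (H.2.2 i i).2
  have hlim : Tendsto (fun k => eLpNorm (fun x => (∑ i, h i i x) - cLaplacian (φ k) x) 2 μ)
      atTop (𝓝 0) := by
    have h0 : Tendsto (fun k => ∑ i, eLpNorm (fun x => h i i x - cpderiv i (cpderiv i (φ k)) x) 2 μ)
        atTop (𝓝 0) := by
      simpa using tendsto_finsetSum Finset.univ fun i _ => hφ2 i i
    refine tendsto_of_tendsto_of_tendsto_of_le_of_le tendsto_const_nhds h0 (fun _ => bot_le)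
      fun k => ?_
    refine le_trans (le_of_eq ?_) (eLpNorm_sum_le (fun i _ => ((H.2.2 i i).2.sub
      ((((hφ k).isTestFun_cpderiv i).isTestFun_cpderiv i).memLp 2 μ)).aestronglyMeasurable)
      (by norm_num))
    congr 1
    ext x
    simp [cLaplacian, Finset.sum_sub_distrib]
  have hx : MemLp (fun x : RH n => x j) 2 μ := memLp_coord_ball R j 2
  refine ⟨_, H.isWeakLaplacian, hf, ?_, fun hz => ?_⟩
  · have ht := tendsto_integral_mul_of_eLpNorm_two hx hf (fun k => (hφ k).isTestFun_cLaplacian.memLp 2 μ) hlim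
    refine tendsto_nhds_unique ht ?_
    simp only [hμ, (hφ _).isTestFun_cLaplacian.setIntegral_mul, (hφ _).integral_coord_mul_cLaplacian]
    exact tendsto_const_nhds
  · have hL : Tendsto (fun k => eLpNorm (cLaplacian (φ k)) 2 μ) atTop (𝓝 0) := by
      refine hlim.congr fun k => ?_
      rw [← eLpNorm_neg]
      refine eLpNorm_congr_ae ?_
      filter_upwards [hz] with x hx
      simp [show ∑ i, h i i x = 0 from hx]
    have h0 : Tendsto (fun k => eLpNorm (fun x => w x - φ k x) 2 μ + ENNReal.ofReal (4 * R ^ 2) *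
        eLpNorm (cLaplacian (φ k)) 2 μ) atTop (𝓝 0) := by
      have h1 := hφ0.add (ENNReal.Tendsto.const_mul hL
        (Or.inr (ENNReal.ofReal_ne_top (r := 4 * R ^ 2))))
      rwa [mul_zero, add_zero] at h1
    have hle : eLpNorm w 2 μ ≤ 0 := by
      refine ge_of_tendsto' h0 fun k => ?_
      have hm := (hφ k).memLp 2 μ
      have hk := (hφ k).eLpNorm_le_cLaplacian j
      calc eLpNorm w 2 μ = eLpNorm ((fun x => w x - φ k x) + φ k) 2 μ := by
            congr 1; ext x; simp
        _ ≤ _ := eLpNorm_add_le (H.1.sub hm).aestronglyMeasurable hm.aestronglyMeasurable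
            (by norm_num)
        _ ≤ _ := by gcongr
    exact (eLpNorm_eq_zero_iff H.1.aestronglyMeasurable two_ne_zero).1 (le_antisymm hle bot_le)

lemma IsWeakLaplacian.sub {Ω : Set (RH n)} {u v f g : RH n → ℝ}
    (hu : MemLp u 2 (volume.restrict Ω)) (hv : MemLp v 2 (volume.restrict Ω))
    (hf : MemLp f 2 (volume.restrict Ω)) (hg : MemLp g 2 (volume.restrict Ω))
    (huf : IsWeakLaplacian Ω u f) (hvg : IsWeakLaplacian Ω v g) :
    IsWeakLaplacian Ω (fun x => u x - v x) (fun x => f x - g x) := by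
  intro φ hφ
  have hφ2 := hφ.memLp 2 (volume.restrict Ω)
  have hL2 := hφ.isTestFun_cLaplacian.memLp 2 (volume.restrict Ω)
  simp only [sub_mul]
  rw [integral_sub (integrable_mul_of_memLp_two hu hL2) (integrable_mul_of_memLp_two hv hL2),
    integral_sub (integrable_mul_of_memLp_two hf hφ2) (integrable_mul_of_memLp_two hg hφ2),
    huf φ hφ, hvg φ hφ]

lemma IsWeakLaplacian.ae_eq {R : ℝ} {u f g : RH n → ℝ}
    (hf : MemLp f 2 (volume.restrict (ball 0 R))) (hg : MemLp g 2 (volume.restrict (ball 0 R)))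
    (huf : IsWeakLaplacian (ball 0 R) u f) (hug : IsWeakLaplacian (ball 0 R) u g) :
    f =ᵐ[volume.restrict (ball 0 R)] g := by
  have : IsFiniteMeasure (volume.restrict (ball (0 : RH n) R)) :=
    isFiniteMeasure_restrict.2 measure_ball_lt_top.ne
  have h := isOpen_ball.ae_eq_zero_of_integral_contDiff_smul_eq_zero (μ := volume)
    (U := ball (0 : RH n) R) (f := fun x => f x - g x)
    (IntegrableOn.locallyIntegrableOn ((hf.sub hg).integrable (by norm_num)))
    fun φ h1 h2 h3 => by
      have hφ : IsTestFun (ball 0 R) φ := ⟨h1, h2, h3⟩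
      have hφ2 := hφ.memLp 2 (volume.restrict (ball 0 R))
      have e : ∀ x, φ x • (f x - g x) = (f x - g x) * φ x := fun x => by
        rw [smul_eq_mul, mul_comm]
      simp only [e]
      rw [← hφ.setIntegral_mul (fun x => f x - g x)]
      simp only [sub_mul]
      rw [integral_sub (integrable_mul_of_memLp_two hf hφ2) (integrable_mul_of_memLp_two hg hφ2),
        ← huf φ hφ, ← hug φ hφ, sub_self]
  filter_upwards [(ae_restrict_iff' measurableSet_ball).2 h] with x hx
  linarith

/-- uniqueness. If `v ∈ H²(B)` solves `Δv = χ_{{v ≠ 0}}` a.e. in a ball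
`B` centered at the origin and `v - u ∈ H₀²(B)`, then `v = u` in `B`. -/
theorem statement6 (n : ℕ) (hn : 0 < n) (R : ℝ) (hR : 0 < R)
    (v lapv : RH n → ℝ) (hv : MemH2 (ball (0 : RH n) R) v)
    (hlapv : IsWeakLaplacian (ball (0 : RH n) R) v lapv)
    (heq : ∀ᵐ (x : RH n) ∂volume.restrict (ball (0 : RH n) R),
      lapv x = if v x ≠ 0 then 1 else 0)
    (hv0 : MemH20 (ball (0 : RH n) R) (fun x => v x - uHalf n hn x)) :
    ∀ᵐ (x : RH n) ∂volume.restrict (ball (0 : RH n) R), v x = uHalf n hn x := by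
  set μ := volume.restrict (ball (0 : RH n) R) with hμ
  have hfin : IsFiniteMeasure μ := isFiniteMeasure_restrict.2 measure_ball_lt_top.ne
  have hv2 : MemLp v 2 μ := by
    obtain ⟨_, _, H⟩ := hv
    exact H.1
  set j : Fin n := ⟨n - 1, by omega⟩ with hj
  have hu2 : MemLp (uHalf n hn) 2 μ := by
    obtain ⟨_, _, H, -⟩ := hv0
    have h := hv2.sub H.1
    convert h using 1
    ext x
    simp
  have hchi : MemLp (fun x : RH n => if 0 < x j then (1 : ℝ) else 0) 2 μ := by
    refine MemLp.of_bound (C := 1) (Measurable.aestronglyMeasurable ?_)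
      (Eventually.of_forall fun x => ?_)
    · exact Measurable.ite (measurableSet_lt measurable_const (by fun_prop)) measurable_const
        measurable_const
    · split_ifs <;> simp
  have hlap2 : MemLp lapv 2 μ := by
    have hnull : NullMeasurableSet {x | v x ≠ 0} μ :=
      hv2.aestronglyMeasurable.nullMeasurableSet_eq_fun aestronglyMeasurable_const |>.compl
    have hind : MemLp (({x | v x ≠ 0}).indicator fun _ => (1 : ℝ)) 2 μ :=
      MemLp.of_bound (C := 1) (aestronglyMeasurable_const.indicator₀ hnull)
        (Eventually.of_forall fun x => by by_cases h : v x = 0 <;> simp [indicator, h])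
    refine hind.ae_eq ?_
    filter_upwards [heq] with x hx
    rw [hx]
    simp [indicator]
  obtain ⟨f, hwf, hf2, hf0, hfw⟩ := hv0.exists_isWeakLaplacian j
  have hfe : f =ᵐ[μ] fun x => lapv x - if 0 < x j then 1 else 0 :=
    hwf.ae_eq hf2 (hlap2.sub hchi)
      (hlapv.sub hv2 hu2 hlap2 hchi (isWeakLaplacian_uHalf hn _))
  have hx2 : MemLp (fun x : RH n => x j) 2 μ := memLp_coord_ball R j 2
  have hneg : 0 ≤ᵐ[μ] fun x => -(x j * f x) := by
    filter_upwards [hfe, heq] with x h1 h2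
    rw [h1, h2]
    simp only [Pi.zero_apply]
    split_ifs <;> simp <;> linarith
  have hprod := (integral_eq_zero_iff_of_nonneg_ae hneg (hx2.integrable_mul hf2).neg).1
    (by rw [integral_neg, hf0, neg_zero])
  have hw := hfw (by
    filter_upwards [hprod, ae_restrict_of_ae (ae_coord_ne_zero j)] with x h1 h2
    simpa [h2] using h1)
  filter_upwards [hw] with x hx
  exact sub_eq_zero.1 hx


end
end

section
/- Let n = 1 and let u : ℝ → ℝ be defined by u(x) = (1/2)x² for x > 0 and u(x) = 0 for x ≤ 0. Then u is not a global minimizer of the one-sided biharmonic Alt–Caffarelli functional F̃: more precisely, the function v(x) = (1/8)x(x+1)² on (−1,1) satisfies v − u ∈ H₀²((−1,1)) and F̃(v, (−1,1)) = 7/8 + 1 < 2 = F̃(u, (−1,1)). -/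
open MeasureTheory Metric Set Filter Topology
open scoped ENNReal

noncomputable section

/-- Smooth compactly supported test functions on `ℝ` with support contained in `Ω`. -/
def IsTestFun1 (Ω : Set ℝ) (φ : ℝ → ℝ) : Prop :=
  ContDiff ℝ (⊤ : ℕ∞) φ ∧ HasCompactSupport φ ∧ tsupport φ ⊆ Ω

/-- `g` is the weak derivative of `u` on `Ω ⊆ ℝ`. -/
def IsWeakDeriv1 (Ω : Set ℝ) (u g : ℝ → ℝ) : Prop :=
  ∀ φ : ℝ → ℝ, IsTestFun1 Ω φ →
    ∫ x in Ω, u x * deriv φ x = - ∫ x in Ω, g x * φ x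

/-- `g` is the weak second derivative (one-dimensional Laplacian) of `u` on `Ω ⊆ ℝ`. -/
def IsWeakLaplacian1 (Ω : Set ℝ) (u g : ℝ → ℝ) : Prop :=
  ∀ φ : ℝ → ℝ, IsTestFun1 Ω φ →
    ∫ x in Ω, u x * deriv (deriv φ) x = ∫ x in Ω, g x * φ x

/-- `u ∈ H²(Ω)` with weak first derivative `g` and weak second derivative `h`. -/
def IsH2With1 (Ω : Set ℝ) (u g h : ℝ → ℝ) : Prop :=
  MemLp u 2 (volume.restrict Ω) ∧
  IsWeakDeriv1 Ω u g ∧ MemLp g 2 (volume.restrict Ω) ∧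
  IsWeakDeriv1 Ω g h ∧ MemLp h 2 (volume.restrict Ω)

/-- `u ∈ H²(Ω)`, `Ω ⊆ ℝ`. -/
def MemH21 (Ω : Set ℝ) (u : ℝ → ℝ) : Prop := ∃ g h, IsH2With1 Ω u g h

/-- `u ∈ H₀²(Ω)`, `Ω ⊆ ℝ`: `u ∈ H²(Ω)` and `u` is approximable in the `H²`-norm by
test functions supported in `Ω`. -/
def MemH201 (Ω : Set ℝ) (u : ℝ → ℝ) : Prop :=
  ∃ g h, IsH2With1 Ω u g h ∧
    ∃ φ : ℕ → ℝ → ℝ, (∀ k, IsTestFun1 Ω (φ k)) ∧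
      Tendsto (fun k => eLpNorm (fun x => u x - φ k x) 2 (volume.restrict Ω)) atTop (𝓝 0) ∧
      Tendsto (fun k => eLpNorm (fun x => g x - deriv (φ k) x) 2 (volume.restrict Ω)) atTop (𝓝 0) ∧
      Tendsto (fun k => eLpNorm (fun x => h x - deriv (deriv (φ k)) x) 2 (volume.restrict Ω))
        atTop (𝓝 0)

/-- `u ∈ H²_loc(ℝ)`. -/
def MemH2loc1 (u : ℝ → ℝ) : Prop :=
  ∀ Ω : Set ℝ, IsOpen Ω → Bornology.IsBounded Ω → MemH21 Ω u

/-- The one-sided biharmonic Alt–Caffarelli functional in dimension one,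
`F̃(u,Ω) = ∫_Ω (u'')² dx + |{x ∈ Ω : u x > 0}|`, where the weak second
derivative `u'' = lapu` is given explicitly. -/
def ACFT1 (Ω : Set ℝ) (lapu u : ℝ → ℝ) : ℝ :=
  (∫ x in Ω, (lapu x) ^ 2) + (volume {x ∈ Ω | 0 < u x}).toReal

/-- `u` is a global minimizer of the one-sided biharmonic Alt–Caffarelli
functional `F̃` in dimension one. -/
def IsGlobalMinimizerT1 (u : ℝ → ℝ) : Prop :=
  MemH2loc1 u ∧
  ∀ Ω : Set ℝ, IsOpen Ω → Bornology.IsBounded Ω →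
    ∀ v : ℝ → ℝ, MemH21 Ω v → MemH201 Ω (fun x => v x - u x) →
      ∀ lapu lapv : ℝ → ℝ, IsWeakLaplacian1 Ω u lapu → IsWeakLaplacian1 Ω v lapv →
        ACFT1 Ω lapu u ≤ ACFT1 Ω lapv v

lemma IsTestFun1.deriv {Ω : Set ℝ} {φ : ℝ → ℝ} (h : IsTestFun1 Ω φ) :
    IsTestFun1 Ω (deriv φ) :=
  ⟨(contDiff_infty_iff_deriv.1 h.1).2, h.2.1.deriv, tsupport_deriv_subset.trans h.2.2⟩

lemma IsTestFun1.hasDerivAt {Ω : Set ℝ} {φ : ℝ → ℝ} (h : IsTestFun1 Ω φ) (x : ℝ) :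
    HasDerivAt φ (_root_.deriv φ x) x :=
  ((contDiff_infty_iff_deriv.1 h.1).1 x).hasDerivAt

lemma IsTestFun1.sub_const_mul {Ω : Set ℝ} {φ η : ℝ → ℝ} (h : IsTestFun1 Ω φ)
    (hη : IsTestFun1 Ω η) (c : ℝ) : IsTestFun1 Ω (fun x => φ x - c * η x) := by
  have hc : HasCompactSupport (fun x => c * η x) := hη.2.1.mul_left (f := fun _ => c)
  refine ⟨h.1.sub (contDiff_const.mul hη.1), h.2.1.sub hc, ?_⟩
  refine (tsupport_sub φ (fun x => c * η x)).trans (union_subset h.2.2 ?_)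
  exact (tsupport_mul_subset_right (f := fun _ => c) (g := η)).trans hη.2.2

lemma IsTestFun1.eq_zero {Ω : Set ℝ} {φ : ℝ → ℝ} (h : IsTestFun1 Ω φ) {x : ℝ} (hx : x ∉ Ω) :
    φ x = 0 :=
  image_eq_zero_of_notMem_tsupport fun hx' => hx (h.2.2 hx')

/-- A test function on an interval with vanishing integral has a primitive which is a test
function. -/
lemma IsTestFun1.primitive {a b : ℝ} {φ : ℝ → ℝ} (h : IsTestFun1 (Ioo a b) φ)
    (hab : a < b) (h0 : ∫ x in a..b, φ x = 0) :
    IsTestFun1 (Ioo a b) (fun x => ∫ t in a..x, φ t) ∧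
      ∀ x, _root_.deriv (fun x => ∫ t in a..x, φ t) x = φ x := by
  have hcont : Continuous φ := h.1.continuous
  have hd : ∀ x, HasDerivAt (fun x => ∫ t in a..x, φ t) (φ x) x := fun x =>
    intervalIntegral.integral_hasDerivAt_right (hcont.intervalIntegrable _ _)
      (hcont.stronglyMeasurableAtFilter _ _) hcont.continuousAt
  have hderiv : _root_.deriv (fun x => ∫ t in a..x, φ t) = φ := funext fun x => (hd x).deriv
  obtain ⟨m, hm⟩ := exists_between hab
  have hK : IsCompact (insert m (tsupport φ)) := h.2.1.isCompact.insert m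
  have hKne : (insert m (tsupport φ)).Nonempty := insert_nonempty _ _
  have hKsub : insert m (tsupport φ) ⊆ Ioo a b := insert_subset hm h.2.2
  have hp := hKsub (hK.sInf_mem hKne)
  have hq := hKsub (hK.sSup_mem hKne)
  set p := sInf (insert m (tsupport φ))
  set q := sSup (insert m (tsupport φ))
  have hzero : ∀ x, x ∉ Icc p q → φ x = 0 := fun x hx =>
    image_eq_zero_of_notMem_tsupport fun hx' =>
      hx ⟨csInf_le hK.bddBelow (Or.inr hx'), le_csSup hK.bddAbove (Or.inr hx')⟩
  have hsupp : ∀ x, x ∉ Icc p q → ∫ t in a..x, φ t = 0 := by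
    intro x hx
    rcases lt_or_ge x p with hxp | hxp
    · exact intervalIntegral.integral_zero_ae (Eventually.of_forall fun t ht => hzero t fun ht' =>
        absurd (ht'.1.trans_lt (ht.2.trans_lt (max_lt hp.1 hxp))) (lt_irrefl _))
    · have hxq : q < x := by
        by_contra! hle
        exact hx ⟨hxp, hle⟩
      have hxb : ∫ t in x..b, φ t = 0 :=
        intervalIntegral.integral_zero_ae (Eventually.of_forall fun t ht => hzero t fun ht' =>
          absurd ((lt_min hxq hq.2).trans_le (ht.1.le.trans ht'.2)) (lt_irrefl _))
      have := intervalIntegral.integral_add_adjacent_intervals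
        (hcont.intervalIntegrable (μ := volume) a x) (hcont.intervalIntegrable x b)
      linarith
  have hts : tsupport (fun x => ∫ t in a..x, φ t) ⊆ Icc p q :=
    closure_minimal (fun x hx => by_contra fun hx' => hx (hsupp x hx')) isClosed_Icc
  refine ⟨⟨?_, HasCompactSupport.intro isCompact_Icc hsupp, hts.trans fun x hx =>
    ⟨hp.1.trans_le hx.1, hx.2.trans_lt hq.2⟩⟩, fun x => (hd x).deriv⟩
  exact contDiff_infty_iff_deriv.2 ⟨fun x => (hd x).differentiableAt, by rw [hderiv]; exact h.1⟩

/-- Classical derivatives off a countable set are weak derivatives. -/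
lemma isWeakDeriv1_Ioo {a b : ℝ} (hab : a ≤ b) {u g : ℝ → ℝ} {s : Set ℝ} (hs : s.Countable)
    (hu : Continuous u) (hg : IntervalIntegrable g volume a b)
    (hd : ∀ x ∉ s, HasDerivAt u (g x) x) : IsWeakDeriv1 (Ioo a b) u g := by
  intro φ hφ
  have hφc : Continuous φ := hφ.1.continuous
  have hi₁ : IntervalIntegrable (fun x => u x * deriv φ x) volume a b :=
    (hu.mul hφ.deriv.1.continuous).intervalIntegrable _ _
  have hi₂ : IntervalIntegrable (fun x => g x * φ x) volume a b :=
    hg.mul_continuousOn hφc.continuousOn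
  have key := integral_eq_of_hasDerivAt_off_countable_of_le (fun x => u x * φ x)
    (fun x => g x * φ x + u x * deriv φ x) hab hs (hu.mul hφc).continuousOn
    (fun x hx => (hd x hx.2).mul (hφ.hasDerivAt x)) (hi₂.add hi₁)
  rw [intervalIntegral.integral_add hi₂ hi₁, hφ.eq_zero (by simp), hφ.eq_zero (by simp),
    intervalIntegral.integral_of_le hab, intervalIntegral.integral_of_le hab,
    integral_Ioc_eq_integral_Ioo, integral_Ioc_eq_integral_Ioo] at key
  linarith

lemma IsWeakDeriv1.isWeakLaplacian1 {Ω : Set ℝ} {u g h : ℝ → ℝ} (hu : IsWeakDeriv1 Ω u g)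
    (hg : IsWeakDeriv1 Ω g h) : IsWeakLaplacian1 Ω u h := by
  intro φ hφ
  rw [hu _ hφ.deriv, hg _ hφ, neg_neg]

/-- Bounded pointwise convergence on the interval `(a, b)`. -/
def TendstoBoundedly (a b : ℝ) (φ : ℕ → ℝ → ℝ) (f : ℝ → ℝ) : Prop :=
  (∃ C, ∀ k, ∀ x ∈ Ioo a b, ‖φ k x‖ ≤ C) ∧
    ∀ x ∈ Ioo a b, Tendsto (fun k => φ k x) atTop (𝓝 (f x))

lemma TendstoBoundedly.sub_mul {a b : ℝ} {φ : ℕ → ℝ → ℝ} {f η : ℝ → ℝ} {c : ℕ → ℝ}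
    (h : TendstoBoundedly a b φ f) (hη : ∃ C, ∀ x, ‖η x‖ ≤ C) (hc : Tendsto c atTop (𝓝 0)) :
    TendstoBoundedly a b (fun k x => φ k x - c k * η x) f := by
  obtain ⟨⟨C, hC⟩, hlim⟩ := h
  obtain ⟨D, hD⟩ := hη
  obtain ⟨E, hE⟩ := hc.norm.bddAbove_range
  refine ⟨⟨C + E * D, fun k x hx => (norm_sub_le _ _).trans (add_le_add (hC k x hx) ?_)⟩,
    fun x hx => by simpa using (hlim x hx).sub (hc.mul_const (η x))⟩
  rw [norm_mul]
  have hk : ‖c k‖ ≤ E := hE (mem_range_self k)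
  exact mul_le_mul hk (hD x) (norm_nonneg _) ((norm_nonneg _).trans hk)

lemma TendstoBoundedly.tendsto_integral {a b : ℝ} {φ : ℕ → ℝ → ℝ} {f : ℝ → ℝ}
    (h : TendstoBoundedly a b φ f) (hφ : ∀ k, Continuous (φ k)) {x : ℝ} (hx : x ∈ Icc a b) :
    Tendsto (fun k => ∫ t in a..x, φ k t) atTop (𝓝 (∫ t in a..x, f t)) := by
  obtain ⟨⟨C, hC⟩, hlim⟩ := h
  have hmem : ∀ᵐ t, t ∈ uIoc a x → t ∈ Ioo a b := by
    filter_upwards [Measure.ae_ne volume b] with t ht htx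
    rw [uIoc_of_le hx.1] at htx
    exact ⟨htx.1, lt_of_le_of_ne (htx.2.trans hx.2) ht⟩
  refine intervalIntegral.tendsto_integral_filter_of_dominated_convergence (fun _ => C)
    (Eventually.of_forall fun k => (hφ k).aestronglyMeasurable)
    (Eventually.of_forall fun k => ?_) intervalIntegrable_const ?_
  · filter_upwards [hmem] with t ht htx using hC k t (ht htx)
  · filter_upwards [hmem] with t ht htx using hlim t (ht htx)

lemma TendstoBoundedly.primitive {a b : ℝ} {φ : ℕ → ℝ → ℝ} {f : ℝ → ℝ}
    (h : TendstoBoundedly a b φ f) (hφ : ∀ k, Continuous (φ k)) :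
    TendstoBoundedly a b (fun k x => ∫ t in a..x, φ k t) (fun x => ∫ t in a..x, f t) := by
  refine ⟨?_, fun x hx => h.tendsto_integral hφ (Ioo_subset_Icc_self hx)⟩
  obtain ⟨⟨C, hC⟩, -⟩ := h
  refine ⟨C * (b - a), fun k x hx => ?_⟩
  have hC0 : 0 ≤ C := (norm_nonneg _).trans (hC k x hx)
  refine (intervalIntegral.norm_integral_le_of_norm_le_const (C := C) fun t ht => ?_).trans ?_
  · rw [uIoc_of_le hx.1.le] at ht
    exact hC k t ⟨ht.1, ht.2.trans_lt hx.2⟩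
  · rw [abs_of_pos (sub_pos.2 hx.1)]
    exact mul_le_mul_of_nonneg_left (by linarith [hx.2]) hC0

lemma TendstoBoundedly.tendsto_eLpNorm {a b : ℝ} {φ : ℕ → ℝ → ℝ} {f : ℝ → ℝ}
    (h : TendstoBoundedly a b φ f) (hφ : ∀ k, Continuous (φ k)) (hf : Measurable f) :
    Tendsto (fun k => eLpNorm (fun x => f x - φ k x) 2 (volume.restrict (Ioo a b)))
      atTop (𝓝 0) := by
  obtain ⟨⟨C, hC⟩, hlim⟩ := h
  have hle : ∀ k, ∀ x ∈ Ioo a b, ‖f x - φ k x‖ ≤ C + C := fun k x hx =>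
    (norm_sub_le _ _).trans (add_le_add
      (le_of_tendsto (hlim x hx).norm (Eventually.of_forall fun k => hC k x hx)) (hC k x hx))
  have hlint : Tendsto (fun k => ∫⁻ x in Ioo a b, ‖f x - φ k x‖ₑ ^ (2 : ℝ)) atTop
      (𝓝 (∫⁻ x in Ioo a b, 0)) := by
    refine tendsto_lintegral_of_dominated_convergence
      (fun _ => ENNReal.ofReal (C + C) ^ (2 : ℝ))
      (fun k => (hf.sub (hφ k).measurable).enorm.pow_const _) (fun k => ?_) ?_ ?_
    · filter_upwards [ae_restrict_mem measurableSet_Ioo] with x hx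
      gcongr
      rw [← ofReal_norm]
      exact ENNReal.ofReal_le_ofReal (hle k x hx)
    · rw [lintegral_const]
      refine ENNReal.mul_ne_top (by finiteness) ?_
      simp
    · filter_upwards [ae_restrict_mem measurableSet_Ioo] with x hx
      have h1 : Tendsto (fun k => ‖f x - φ k x‖ₑ) atTop (𝓝 0) := by
        simpa using ((hlim x hx).const_sub (f x)).enorm
      simpa using h1.ennrpow_const 2
  have h2 := hlint.ennrpow_const (1 / 2)
  simp only [lintegral_zero] at h2
  rw [ENNReal.zero_rpow_of_pos (by norm_num)] at h2
  simpa [eLpNorm_eq_lintegral_rpow_enorm_toReal] using h2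

/-- If test functions `φ k` converge boundedly to `f` and the primitive `F` of `f` vanishes at both
endpoints, then `F` is a bounded limit of test functions whose derivatives are small perturbations
of `φ k`. -/
lemma TendstoBoundedly.exists_testFun_primitive {a b : ℝ} (hab : a < b) {φ : ℕ → ℝ → ℝ}
    {f F η : ℝ → ℝ} (hφ : ∀ k, IsTestFun1 (Ioo a b) (φ k)) (h : TendstoBoundedly a b φ f)
    (hη : IsTestFun1 (Ioo a b) η) (hη1 : ∫ x in a..b, η x = 1)
    (hF : ∀ x ∈ Icc a b, ∫ t in a..x, f t = F x) (hFb : F b = 0) :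
    ∃ (Φ : ℕ → ℝ → ℝ) (c : ℕ → ℝ), (∀ k, IsTestFun1 (Ioo a b) (Φ k)) ∧
      (∀ k, deriv (Φ k) = fun x => φ k x - c k * η x) ∧ Tendsto c atTop (𝓝 0) ∧
      TendstoBoundedly a b Φ F := by
  have hc : Tendsto (fun k => ∫ x in a..b, φ k x) atTop (𝓝 0) := by
    rw [← hFb, ← hF b (right_mem_Icc.2 hab.le)]
    exact h.tendsto_integral (fun k => (hφ k).1.continuous) (right_mem_Icc.2 hab.le)
  set c : ℕ → ℝ := fun k => ∫ x in a..b, φ k x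
  have htest : ∀ k, IsTestFun1 (Ioo a b) (fun x => φ k x - c k * η x) :=
    fun k => (hφ k).sub_const_mul hη (c k)
  have hval : ∀ k, ∫ x in a..b, (φ k x - c k * η x) = 0 := by
    intro k
    rw [intervalIntegral.integral_sub ((hφ k).1.continuous.intervalIntegrable _ _)
      ((hη.1.continuous.const_mul _).intervalIntegrable _ _),
      intervalIntegral.integral_const_mul, hη1, mul_one, sub_self]
  refine ⟨fun k x => ∫ t in a..x, (φ k t - c k * η t), c,
    fun k => ((htest k).primitive hab (hval k)).1,
    fun k => funext ((htest k).primitive hab (hval k)).2, hc, ?_⟩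
  have hlim := (h.sub_mul (hη.1.continuous.bounded_above_of_compact_support hη.2.1) hc).primitive
    fun k => (htest k).1.continuous
  exact ⟨hlim.1, fun x hx => hF x (Ioo_subset_Icc_self hx) ▸ hlim.2 x hx⟩

lemma exists_testFun_integral_eq_one {a b : ℝ} (hab : a < b) :
    ∃ η, IsTestFun1 (Ioo a b) η ∧ ∫ x in a..b, η x = 1 := by
  let f : ContDiffBump ((a + b) / 2) := ⟨(b - a) / 8, (b - a) / 4, by linarith, by linarith⟩
  have hts : tsupport (f.normed volume) ⊆ Ioo a b := by
    rw [f.tsupport_normed_eq, Real.closedBall_eq_Icc]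
    intro x hx
    have h1 : (a + b) / 2 - (b - a) / 4 ≤ x := hx.1
    have h2 : x ≤ (a + b) / 2 + (b - a) / 4 := hx.2
    exact ⟨by linarith, by linarith⟩
  refine ⟨f.normed volume, ⟨f.contDiff_normed, f.hasCompactSupport_normed, hts⟩, ?_⟩
  rw [intervalIntegral.integral_of_le hab.le, setIntegral_eq_integral_of_forall_compl_eq_zero,
    f.integral_normed]
  exact fun x hx => image_eq_zero_of_notMem_tsupport fun hx' => hx (Ioo_subset_Ioc_self (hts hx'))

lemma memLp_two_Ioo_of_continuous {a b : ℝ} {f : ℝ → ℝ} (hf : Continuous f) :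
    MemLp f 2 (volume.restrict (Ioo a b)) := by
  obtain ⟨C, hC⟩ := isCompact_Icc.exists_bound_of_continuousOn (hf.continuousOn (s := Icc a b))
  refine MemLp.of_bound hf.aestronglyMeasurable C ?_
  filter_upwards [ae_restrict_mem measurableSet_Ioo] with x hx using hC x (Ioo_subset_Icc_self hx)

/-- A criterion for membership in `H₀²`: the function and its derivative vanish at the endpoints,
and the second derivative is a bounded limit of test functions. -/
lemma memH201_Ioo {a b : ℝ} (hab : a < b) {u g h : ℝ → ℝ} {s : Set ℝ} (hs : s.Countable)
    (hu : Continuous u) (hg : Continuous g) (hh : Measurable h)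
    (hh2 : MemLp h 2 (volume.restrict (Ioo a b))) (hug : ∀ x, HasDerivAt u (g x) x)
    (hgh : ∀ x ∉ s, HasDerivAt g (h x) x) (hua : u a = 0) (hub : u b = 0) (hga : g a = 0)
    (hgb : g b = 0) {ψ : ℕ → ℝ → ℝ} (hψ : ∀ k, IsTestFun1 (Ioo a b) (ψ k))
    (hlim : TendstoBoundedly a b ψ h) : MemH201 (Ioo a b) u := by
  have hhi : IntervalIntegrable h volume a b :=
    (intervalIntegrable_iff_integrableOn_Ioo_of_le hab.le).2 (hh2.integrable (by norm_num))
  have hGu : ∀ x ∈ Icc a b, ∫ t in a..x, g t = u x := fun x _ => by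
    rw [intervalIntegral.integral_eq_sub_of_hasDerivAt (fun t _ => hug t)
      (hg.intervalIntegrable _ _), hua, sub_zero]
  have hHg : ∀ x ∈ Icc a b, ∫ t in a..x, h t = g x := fun x hx => by
    rw [integral_eq_of_hasDerivAt_off_countable_of_le g h hx.1 hs hg.continuousOn
      (fun t ht => hgh t ht.2) (hhi.mono_set ?_), hga, sub_zero]
    rw [uIcc_of_le hx.1, uIcc_of_le hab.le]
    exact Icc_subset_Icc_right hx.2
  obtain ⟨η, hη, hη1⟩ := exists_testFun_integral_eq_one hab
  obtain ⟨Φ, c, hΦ, hΦ', hc, hΦlim⟩ :=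
    hlim.exists_testFun_primitive hab hψ hη hη1 hHg hgb
  obtain ⟨Ψ, d, hΨ, hΨ', hd, hΨlim⟩ :=
    hΦlim.exists_testFun_primitive hab hΦ hη hη1 hGu hub
  have hbd : ∀ {θ : ℝ → ℝ}, IsTestFun1 (Ioo a b) θ → ∃ C, ∀ x, ‖θ x‖ ≤ C :=
    fun hθ => hθ.1.continuous.bounded_above_of_compact_support hθ.2.1
  have hΨ'lim : TendstoBoundedly a b (fun k => deriv (Ψ k)) g := by
    simp only [hΨ']
    exact hΦlim.sub_mul (hbd hη) hd
  have hΨ'' : ∀ k, deriv (deriv (Ψ k)) = fun x => (ψ k x - c k * η x) - d k * deriv η x := by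
    intro k
    rw [hΨ']
    funext x
    have hderiv := ((hΦ k).hasDerivAt x).fun_sub ((hη.hasDerivAt x).const_mul (d k))
    rw [hderiv.deriv, hΦ']
  have hΨ''lim : TendstoBoundedly a b (fun k => deriv (deriv (Ψ k))) h := by
    simp only [hΨ'']
    exact (hlim.sub_mul (hbd hη) hc).sub_mul (hbd hη.deriv) hd
  refine ⟨g, h, ⟨memLp_two_Ioo_of_continuous hu, ?_, memLp_two_Ioo_of_continuous hg, ?_, hh2⟩,
    Ψ, hΨ, hΨlim.tendsto_eLpNorm (fun k => (hΨ k).1.continuous) hu.measurable,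
    hΨ'lim.tendsto_eLpNorm (fun k => (hΨ k).deriv.1.continuous) hg.measurable,
    hΨ''lim.tendsto_eLpNorm (fun k => (hΨ k).deriv.deriv.1.continuous) hh⟩
  · exact isWeakDeriv1_Ioo hab.le countable_empty hu (hg.intervalIntegrable _ _) fun x _ => hug x
  · exact isWeakDeriv1_Ioo hab.le hs hg hhi hgh

lemma tendsto_smoothTransition_nat_mul (x : ℝ) :
    Tendsto (fun k : ℕ => Real.smoothTransition (k * x)) atTop (𝓝 (if 0 < x then 1 else 0)) := by
  split_ifs with hx
  · refine tendsto_const_nhds.congr' ?_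
    filter_upwards [(tendsto_natCast_atTop_atTop.atTop_mul_const hx).eventually_ge_atTop 1]
      with k hk using (Real.smoothTransition.one_of_one_le hk).symm
  · refine tendsto_const_nhds.congr fun k => ?_
    exact (Real.smoothTransition.zero_of_nonpos
      (mul_nonpos_of_nonneg_of_nonpos k.cast_nonneg (not_lt.1 hx))).symm

/-- Cutting off a boundedly convergent sequence of smooth functions gives test functions with the
same limit. -/
lemma exists_testFun_tendstoBoundedly {f : ℝ → ℝ} {r : ℝ} (hr : 0 < r) {φ : ℕ → ℝ → ℝ}
    (hφ : ∀ k, ContDiff ℝ (⊤ : ℕ∞) (φ k)) (h : TendstoBoundedly (-r) r φ f) :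
    ∃ ψ : ℕ → ℝ → ℝ, (∀ k, IsTestFun1 (Ioo (-r) r) (ψ k)) ∧ TendstoBoundedly (-r) r ψ f := by
  have hu : ∀ k : ℕ, 0 < 1 / ((k : ℝ) + 2) ∧ 1 / ((k : ℝ) + 2) < 1 := fun k => by
    have hk : (0 : ℝ) ≤ k := k.cast_nonneg
    exact ⟨by positivity, by rw [div_lt_one (by positivity)]; linarith⟩
  let χ : ℕ → ContDiffBump (0 : ℝ) := fun k =>
    ⟨r * (1 - 1 / ((k : ℝ) + 2)), r * (1 - 1 / ((k : ℝ) + 2) / 2),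
      mul_pos hr (by linarith [hu k]), mul_lt_mul_of_pos_left (by linarith [hu k]) hr⟩
  have hχ : ∀ k, tsupport (χ k) ⊆ Ioo (-r) r := fun k => by
    rw [(χ k).tsupport_eq, Real.closedBall_eq_Icc]
    have h1 : (χ k).rOut < r := by
      change r * (1 - 1 / ((k : ℝ) + 2) / 2) < r
      nlinarith [hu k]
    intro x hx
    exact ⟨by linarith [hx.1], by linarith [hx.2]⟩
  refine ⟨fun k x => χ k x * φ k x, fun k => ⟨(χ k).contDiff.mul (hφ k),
    (χ k).hasCompactSupport.mul_right, tsupport_mul_subset_left.trans (hχ k)⟩, ?_, ?_⟩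
  · obtain ⟨⟨C, hC⟩, -⟩ := h
    refine ⟨C, fun k x hx => ?_⟩
    rw [norm_mul, Real.norm_of_nonneg (χ k).nonneg]
    exact (mul_le_of_le_one_left (norm_nonneg _) (χ k).le_one).trans (hC k x hx)
  · intro x hx
    refine (h.2 x hx).congr' ?_
    have hlim : Tendsto (fun k : ℕ => r * (1 - 1 / ((k : ℝ) + 2))) atTop (𝓝 r) := by
      have h0 : Tendsto (fun k : ℕ => 1 / ((k : ℝ) + 2)) atTop (𝓝 0) := by
        simp only [one_div]
        exact (tendsto_natCast_atTop_atTop.atTop_add tendsto_const_nhds).inv_tendsto_atTop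
      simpa using (h0.const_sub 1).const_mul r
    filter_upwards [hlim.eventually_const_lt (abs_lt.2 ⟨hx.1, hx.2⟩)] with k hk
    have hmem : x ∈ closedBall (0 : ℝ) (χ k).rIn := by
      rw [mem_closedBall, Real.dist_eq, sub_zero]
      exact hk.le
    rw [(χ k).one_of_mem_closedBall hmem, one_mul]

lemma halfParabola_eq :
    (fun x : ℝ => if 0 < x then x ^ 2 / 2 else 0) = fun x => max x 0 ^ 2 / 2 := by
  funext x
  split_ifs with hx
  · rw [max_eq_left hx.le]
  · rw [max_eq_right (not_lt.1 hx)]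
    norm_num

lemma hasDerivAt_max_zero {x : ℝ} (hx : x ∉ ({0} : Set ℝ)) :
    HasDerivAt (fun x : ℝ => max x 0) (if 0 < x then 1 else 0) x := by
  rcases lt_or_gt_of_ne (show x ≠ 0 from hx) with h | h
  · rw [if_neg h.le.not_gt]
    refine (hasDerivAt_const x (0 : ℝ)).congr_of_eventuallyEq ?_
    filter_upwards [gt_mem_nhds h] with y hy using max_eq_right hy.le
  · rw [if_pos h]
    refine (hasDerivAt_id x).congr_of_eventuallyEq ?_
    filter_upwards [lt_mem_nhds h] with y hy using max_eq_left hy.le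

lemma hasDerivAt_max_zero_sq (x : ℝ) :
    HasDerivAt (fun x : ℝ => max x 0 ^ 2 / 2) (max x 0) x := by
  rcases eq_or_ne x 0 with rfl | hx
  · have h : (fun x : ℝ => max x 0 ^ 2 / 2) =O[𝓝 0] fun x => ‖x - 0‖ ^ 2 := by
      refine Asymptotics.IsBigO.of_bound 1 (Eventually.of_forall fun y => ?_)
      rw [sub_zero, one_mul, Real.norm_of_nonneg (by positivity), norm_pow, norm_norm,
        Real.norm_eq_abs, sq_abs]
      rcases le_total y 0 with h | h
      · rw [max_eq_right h]; nlinarith [sq_nonneg y]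
      · rw [max_eq_left h]; nlinarith [sq_nonneg y]
    have hd : HasFDerivAt (fun x : ℝ => max x 0 ^ 2 / 2) (0 : ℝ →L[ℝ] ℝ) 0 :=
      h.hasFDerivAt one_lt_two
    simpa using hd.hasDerivAt
  · refine (((hasDerivAt_max_zero hx).fun_pow 2).div_const 2).congr_deriv ?_
    split_ifs with h
    · simp
    · simp [not_lt.1 h]

lemma hasDerivAt_cubic (x : ℝ) :
    HasDerivAt (fun x : ℝ => x * (x + 1) ^ 2 / 8) ((x + 1) * (3 * x + 1) / 8) x := by
  refine (((hasDerivAt_id' x).fun_mul (((hasDerivAt_id' x).add_const 1).fun_pow 2)).div_const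
    8).congr_deriv ?_
  norm_num
  ring

lemma hasDerivAt_cubic_deriv (x : ℝ) :
    HasDerivAt (fun x : ℝ => (x + 1) * (3 * x + 1) / 8) ((3 * x + 2) / 4) x := by
  refine ((((hasDerivAt_id' x).add_const 1).fun_mul
    (((hasDerivAt_id' x).const_mul 3).add_const 1)).div_const 8).congr_deriv ?_
  ring

lemma measurable_step : Measurable (fun x : ℝ => if 0 < x then (1 : ℝ) else 0) :=
  Measurable.ite measurableSet_Ioi measurable_const measurable_const

lemma intervalIntegrable_step (a b : ℝ) :
    IntervalIntegrable (fun x : ℝ => if 0 < x then (1 : ℝ) else 0) volume a b :=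
  (intervalIntegrable_const (c := (1 : ℝ))).mono_fun measurable_step.aestronglyMeasurable
    (Eventually.of_forall fun x => by dsimp only; split_ifs <;> simp)

lemma memH201_cubic_sub_halfParabola : MemH201 (Ioo (-1 : ℝ) 1)
    (fun x => x * (x + 1) ^ 2 / 8 - (if 0 < x then x ^ 2 / 2 else 0)) := by
  have hbound : ∀ x ∈ Ioo (-1 : ℝ) 1, ‖(3 * x + 2) / 4‖ ≤ 2 := fun x hx => by
    rw [Real.norm_eq_abs, abs_le]
    constructor <;> linarith [hx.1, hx.2]
  have hlim : TendstoBoundedly (-1) 1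
      (fun k x => (3 * x + 2) / 4 - Real.smoothTransition (k * x))
      (fun x => (3 * x + 2) / 4 - if 0 < x then 1 else 0) := by
    refine ⟨⟨2 + 1, fun k x hx => (norm_sub_le _ _).trans (add_le_add (hbound x hx) ?_)⟩,
      fun x _ => (tendsto_smoothTransition_nat_mul x).const_sub _⟩
    rw [Real.norm_of_nonneg (Real.smoothTransition.nonneg _)]
    exact Real.smoothTransition.le_one _
  obtain ⟨ψ, hψ, hψlim⟩ := exists_testFun_tendstoBoundedly one_pos (fun k =>
    (ContDiff.sub (by fun_prop) (Real.smoothTransition.contDiff.comp (by fun_prop)))) hlim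
  have hu : (fun x : ℝ => x * (x + 1) ^ 2 / 8 - (if 0 < x then x ^ 2 / 2 else 0)) =
      fun x => x * (x + 1) ^ 2 / 8 - max x 0 ^ 2 / 2 :=
    funext fun x => congrArg (x * (x + 1) ^ 2 / 8 - ·) (congrFun halfParabola_eq x)
  have hmeas : Measurable fun x : ℝ => (3 * x + 2) / 4 - if 0 < x then 1 else 0 :=
    Measurable.sub (by fun_prop) measurable_step
  rw [hu]
  refine memH201_Ioo (by norm_num) (countable_singleton 0) (by fun_prop)
    (g := fun x => (x + 1) * (3 * x + 1) / 8 - max x 0) (by fun_prop) hmeas ?_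
    (fun x => (hasDerivAt_cubic x).sub (hasDerivAt_max_zero_sq x))
    (fun x hx => (hasDerivAt_cubic_deriv x).sub (hasDerivAt_max_zero hx))
    (by norm_num) (by norm_num) (by norm_num) (by norm_num) hψ hψlim
  refine MemLp.of_bound hmeas.aestronglyMeasurable (2 + 1) ?_
  filter_upwards [ae_restrict_mem measurableSet_Ioo] with x hx
  refine (norm_sub_le _ _).trans (add_le_add (hbound x hx) ?_)
  split_ifs <;> simp

lemma isWeakLaplacian1_halfParabola : IsWeakLaplacian1 (Ioo (-1 : ℝ) 1)
    (fun x : ℝ => if 0 < x then x ^ 2 / 2 else 0) (fun x : ℝ => if 0 < x then 1 else 0) := by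
  rw [halfParabola_eq]
  have hc : Continuous fun x : ℝ => max x 0 := by fun_prop
  exact (isWeakDeriv1_Ioo (by norm_num) countable_empty (by fun_prop)
    (hc.intervalIntegrable _ _) fun x _ => hasDerivAt_max_zero_sq x).isWeakLaplacian1
    (isWeakDeriv1_Ioo (by norm_num) (countable_singleton 0) hc (intervalIntegrable_step _ _)
      fun x hx => hasDerivAt_max_zero hx)

lemma isH2With1_cubic : IsH2With1 (Ioo (-1 : ℝ) 1) (fun x : ℝ => x * (x + 1) ^ 2 / 8)
    (fun x => (x + 1) * (3 * x + 1) / 8) (fun x => (3 * x + 2) / 4) := by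
  have hg : Continuous fun x : ℝ => (x + 1) * (3 * x + 1) / 8 := by fun_prop
  have hh : Continuous fun x : ℝ => (3 * x + 2) / 4 := by fun_prop
  exact ⟨memLp_two_Ioo_of_continuous (by fun_prop),
    isWeakDeriv1_Ioo (by norm_num) countable_empty (by fun_prop) (hg.intervalIntegrable _ _)
      fun x _ => hasDerivAt_cubic x,
    memLp_two_Ioo_of_continuous hg,
    isWeakDeriv1_Ioo (by norm_num) countable_empty hg (hh.intervalIntegrable _ _)
      fun x _ => hasDerivAt_cubic_deriv x,
    memLp_two_Ioo_of_continuous hh⟩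

lemma acft1_cubic : ACFT1 (Ioo (-1 : ℝ) 1) (fun x : ℝ => (3 * x + 2) / 4)
    (fun x : ℝ => x * (x + 1) ^ 2 / 8) = 7 / 8 + 1 := by
  have hset : {x ∈ Ioo (-1 : ℝ) 1 | 0 < x * (x + 1) ^ 2 / 8} = Ioo 0 1 := by
    ext x
    simp only [mem_ofPred_eq, mem_Ioo]
    constructor
    · rintro ⟨⟨-, h1⟩, h⟩
      exact ⟨pos_of_mul_pos_left (by linarith) (sq_nonneg (x + 1)), h1⟩
    · rintro ⟨h0, h1⟩
      exact ⟨⟨by linarith, h1⟩, by positivity⟩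
  have hval : ∫ x in (-1 : ℝ)..1, ((3 * x + 2) / 4) ^ 2 = 7 / 8 := by
    have hd : ∀ x : ℝ, HasDerivAt (fun x : ℝ => (3 * x + 2) ^ 3 / 144) (((3 * x + 2) / 4) ^ 2) x :=
      fun x => by
        refine (((((hasDerivAt_id' x).const_mul 3).add_const 2).fun_pow 3).div_const
          144).congr_deriv ?_
        norm_num
        ring
    rw [intervalIntegral.integral_eq_sub_of_hasDerivAt (fun x _ => hd x)
      (Continuous.intervalIntegrable (by fun_prop) _ _)]
    norm_num
  rw [ACFT1, hset, ← integral_Ioc_eq_integral_Ioo,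
    ← intervalIntegral.integral_of_le (by norm_num), hval]
  simp

lemma acft1_halfParabola : ACFT1 (Ioo (-1 : ℝ) 1) (fun x : ℝ => if 0 < x then 1 else 0)
    (fun x : ℝ => if 0 < x then x ^ 2 / 2 else 0) = 2 := by
  have hset : {x ∈ Ioo (-1 : ℝ) 1 | 0 < if 0 < x then x ^ 2 / 2 else 0} = Ioo 0 1 := by
    ext x
    simp only [mem_ofPred_eq, mem_Ioo]
    constructor
    · rintro ⟨⟨-, h1⟩, h⟩
      split_ifs at h with h0
      · exact ⟨h0, h1⟩
      · exact absurd h (lt_irrefl _)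
    · rintro ⟨h0, h1⟩
      rw [if_pos h0]
      exact ⟨⟨by linarith, h1⟩, by positivity⟩
  have hind : (fun x : ℝ => (if 0 < x then (1 : ℝ) else 0) ^ 2) =
      (Ioi (0 : ℝ)).indicator fun _ => 1 := by
    funext x
    by_cases hx : 0 < x <;> simp [hx]
  have hval : ∫ x in Ioo (-1 : ℝ) 1, (if 0 < x then (1 : ℝ) else 0) ^ 2 = 1 := by
    rw [hind, setIntegral_indicator measurableSet_Ioi, Ioo_inter_Ioi]
    simp
  rw [ACFT1, hset, hval]
  norm_num

/-- in dimension one, the half-line function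
`u(x) = ½ x² 𝟙_{x>0}` is not a global minimizer of the one-sided functional `F̃`.
More precisely, `v(x) = ⅛ x (x+1)²` satisfies `v - u ∈ H₀²((-1,1))`,
`v'' (x) = ¼(3x+2)`, `u'' = χ_{(0,1)}` on `(-1,1)`, and
`F̃(v,(-1,1)) = 7/8 + 1 < 2 = F̃(u,(-1,1))`. -/
theorem statement8 :
    ¬ IsGlobalMinimizerT1 (fun x : ℝ => if 0 < x then x ^ 2 / 2 else 0) ∧
    MemH201 (Set.Ioo (-1 : ℝ) 1)
      (fun x => x * (x + 1) ^ 2 / 8 - (if 0 < x then x ^ 2 / 2 else 0)) ∧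
    IsWeakLaplacian1 (Set.Ioo (-1 : ℝ) 1) (fun x : ℝ => if 0 < x then x ^ 2 / 2 else 0)
      (fun x : ℝ => if 0 < x then 1 else 0) ∧
    IsWeakLaplacian1 (Set.Ioo (-1 : ℝ) 1) (fun x : ℝ => x * (x + 1) ^ 2 / 8)
      (fun x : ℝ => (3 * x + 2) / 4) ∧
    ACFT1 (Set.Ioo (-1 : ℝ) 1) (fun x : ℝ => (3 * x + 2) / 4)
      (fun x : ℝ => x * (x + 1) ^ 2 / 8) = 7 / 8 + 1 ∧
    ACFT1 (Set.Ioo (-1 : ℝ) 1) (fun x : ℝ => if 0 < x then 1 else 0)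
      (fun x : ℝ => if 0 < x then x ^ 2 / 2 else 0) = 2 ∧
    (7 / 8 + 1 : ℝ) < 2 := by
  have hlap := isH2With1_cubic.2.1.isWeakLaplacian1 isH2With1_cubic.2.2.2.1
  refine ⟨fun hmin => ?_, memH201_cubic_sub_halfParabola, isWeakLaplacian1_halfParabola, hlap,
    acft1_cubic, acft1_halfParabola, by norm_num⟩
  have hle := hmin.2 _ isOpen_Ioo (isBounded_Ioo (-1) 1) _ ⟨_, _, isH2With1_cubic⟩
    memH201_cubic_sub_halfParabola _ _ isWeakLaplacian1_halfParabola hlap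
  rw [acft1_cubic, acft1_halfParabola] at hle
  norm_num at hle

end
end
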